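/- Let η, ζ ∈ S_∞ with η ⪯ ζ. Then the map ξ ↦ ξη⁻¹ induces an order isomorphism from the interval [η,ζ]_⪯ = {ξ : η ⪯ ξ ⪯ ζ} onto the interval [e, ζη⁻¹]_⪯ = {ξ : e ⪯ ξ ⪯ ζη⁻¹}. -/

import Mathlib

/-- A permutation of the positive integers belongs to `S_∞` when it moves only
finitely many points. -/
def FinSupp (w : Equiv.Perm ℕ+) : Prop := {x : ℕ+ | w x ≠ x}.Finite

/-- The length `ℓ(w)` of a permutation: its number of inversions, i.e. of pairs
`i < j` with `w i > w j`. -/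
noncomputable def len (w : Equiv.Perm ℕ+) : ℕ :=
  Set.ncard {p : ℕ+ × ℕ+ | p.1 < p.2 ∧ w p.2 < w p.1}

/-- Covering relation of the `k`-Bruhat order: `u ⋖_k u(a,b)` for `a ≤ k < b`
with `ℓ(u(a,b)) = ℓ(u) + 1`.  Here `u(a,b) = u * (swap a b)`. -/
def kBruhatCov (k : ℕ+) (u w : Equiv.Perm ℕ+) : Prop :=
  ∃ a b : ℕ+, a ≤ k ∧ k < b ∧ w = u * Equiv.swap a b ∧ len w = len u + 1

/-- The `k`-Bruhat order `u ≤_k w`: a chain of `k`-Bruhat covers from `u` to `w`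
(or `u = w`). -/
def kBruhat (k : ℕ+) : Equiv.Perm ℕ+ → Equiv.Perm ℕ+ → Prop :=
  Relation.ReflTransGen (kBruhatCov k)
/-- The new partial order `⪯` on `S_∞`: `η ⪯ ζ` iff there exist `u ∈ S_∞` and
`k` with `u ≤_k ηu ≤_k ζu`. -/
def NewOrder (η ζ : Equiv.Perm ℕ+) : Prop :=
  ∃ (u : Equiv.Perm ℕ+) (k : ℕ+), FinSupp u ∧
    kBruhat k u (η * u) ∧ kBruhat k (η * u) (ζ * u)

open Equiv in
theorem FinSupp.mul_swap {u : Perm ℕ+} (hu : FinSupp u) (a b : ℕ+) :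
    FinSupp (u * swap a b) := by
  refine (hu.union (Set.toFinite {a, b})).subset fun x hx => ?_
  by_contra hn
  simp only [Set.mem_union, Set.mem_ofPred_eq, Set.mem_insert_iff, Set.mem_singleton_iff,
    not_or, not_not] at hn
  obtain ⟨h1, h2, h3⟩ := hn
  exact hx (by rw [Perm.mul_apply, swap_apply_of_ne_of_ne h2 h3, h1])

/-- The set of inversions of a permutation. -/
def inversions (w : Equiv.Perm ℕ+) : Set (ℕ+ × ℕ+) :=
  {p | p.1 < p.2 ∧ w p.2 < w p.1}

theorem mem_inversions {w : Equiv.Perm ℕ+} {i j : ℕ+} :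
    (i, j) ∈ inversions w ↔ i < j ∧ w j < w i := Iff.rfl

theorem FinSupp.finite_inversions {u : Equiv.Perm ℕ+} (hu : FinSupp u) :
    (inversions u).Finite := by
  obtain ⟨M, hM⟩ := hu.bddAbove
  refine ((Set.finite_Icc 1 M).prod (Set.finite_Icc 1 M)).subset ?_
  rintro ⟨i, j⟩ ⟨hij, hu'⟩
  dsimp only at hij hu'
  have fixed : ∀ x, M < x → u x = x := fun x hx => by
    by_contra hne
    exact absurd (hM hne) (not_le.2 hx)
  have hj : j ≤ M := by
    by_contra! hj
    rw [fixed j hj] at hu'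
    have := u.injective (fixed (u i) (hj.trans hu'))
    exact absurd (hij.trans hu') (by simp [this])
  exact ⟨⟨one_le, hij.le.trans hj⟩, one_le, hj⟩

open Classical in
/-- The involution on ordered pairs of positions which applies `swap a b` to both
entries whenever this keeps them in increasing order. -/
noncomputable def swapPair (a b : ℕ+) (p : ℕ+ × ℕ+) : ℕ+ × ℕ+ :=
  if Equiv.swap a b p.1 < Equiv.swap a b p.2 then (Equiv.swap a b p.1, Equiv.swap a b p.2) else p

theorem swapPair_swapPair (a b : ℕ+) {p : ℕ+ × ℕ+} (hp : p.1 < p.2) :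
    swapPair a b (swapPair a b p) = p := by
  unfold swapPair
  split_ifs <;> simp_all

theorem swapPair_injOn_inversions (a b : ℕ+) (u : Equiv.Perm ℕ+) :
    Set.InjOn (swapPair a b) (inversions u) := fun p hp q hq h => by
  rw [← swapPair_swapPair a b hp.1, h, swapPair_swapPair a b hq.1]

section Swap

variable {u : Equiv.Perm ℕ+} {a b : ℕ+}

theorem mem_inversions_mul_swap (hab : a < b) (hu : u a < u b) :
    (a, b) ∈ inversions (u * Equiv.swap a b) := by
  simp [mem_inversions, hab, hu]

theorem swapPair_image_subset (hab : a < b) (hu : u a < u b) :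
    swapPair a b '' inversions u ⊆ inversions (u * Equiv.swap a b) \ {(a, b)} := by
  rintro _ ⟨⟨i, j⟩, ⟨hij, hinv⟩, rfl⟩
  dsimp only at hij hinv
  unfold swapPair
  split_ifs with h
  · refine ⟨⟨h, by simpa using hinv⟩, fun hmem => ?_⟩
    simp only [Set.mem_singleton_iff, Prod.mk.injEq, Equiv.swap_apply_eq_iff,
      Equiv.swap_apply_left, Equiv.swap_apply_right] at hmem
    exact absurd hij (by simp [hmem.1, hmem.2, hab.le])
  · refine ⟨⟨hij, ?_⟩, ?_⟩
    · simp only [Equiv.swap_apply_def, Equiv.Perm.mul_apply] at h ⊢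
      grind
    · simp only [Set.mem_singleton_iff, Prod.mk.injEq]
      rintro ⟨rfl, rfl⟩
      exact lt_asymm hu hinv

theorem swapPair_image_eq (hab : a < b) (hu : u a < u b)
    (hN : ∀ c, a < c → c < b → u a < u c → u b ≤ u c) :
    swapPair a b '' inversions u = inversions (u * Equiv.swap a b) \ {(a, b)} := by
  refine (swapPair_image_subset hab hu).antisymm ?_
  rintro ⟨i, j⟩ ⟨⟨hij, hinv⟩, hne⟩
  refine ⟨swapPair a b (i, j), ?_, swapPair_swapPair a b hij⟩
  dsimp only at hij hinv
  unfold swapPair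
  split_ifs with h
  · exact ⟨h, hinv⟩
  · refine ⟨hij, ?_⟩
    have hinj := u.injective
    simp only [Equiv.swap_apply_def, Equiv.Perm.mul_apply, Set.mem_singleton_iff,
      Prod.mk.injEq] at h hinv hne ⊢
    have h1 := hN i
    have h2 := hN j
    have h3 : i ≠ a → u i ≠ u a := fun h => hinj.ne h
    have h4 : j ≠ a → u j ≠ u a := fun h => hinj.ne h
    have h5 : i ≠ b → u i ≠ u b := fun h => hinj.ne h
    have h6 := lt_trichotomy i a
    have h7 := lt_trichotomy j b
    split_ifs at h hinv <;> grind

theorem len_mul_swap_eq (hf : FinSupp u) (hab : a < b) (hu : u a < u b)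
    (hN : ∀ c, a < c → c < b → u a < u c → u b ≤ u c) :
    len (u * Equiv.swap a b) = len u + 1 := by
  have h1 := Set.ncard_sdiff_singleton_add_one (mem_inversions_mul_swap hab hu)
    (hf.mul_swap a b).finite_inversions
  rw [← swapPair_image_eq hab hu hN,
    (swapPair_injOn_inversions a b u).ncard_image] at h1
  exact h1.symm

theorem len_lt_len_mul_swap (hf : FinSupp u) (hab : a < b) (hu : u a < u b) :
    len u < len (u * Equiv.swap a b) := by
  have hfin := (hf.mul_swap a b).finite_inversions
  have h1 := Set.ncard_sdiff_singleton_add_one (mem_inversions_mul_swap hab hu) hfin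
  have h2 := Set.ncard_le_ncard (swapPair_image_subset hab hu) hfin.sdiff
  rw [(swapPair_injOn_inversions a b u).ncard_image] at h2
  change (inversions u).ncard < (inversions (u * Equiv.swap a b)).ncard
  omega

theorem lt_and_not_between_of_len_mul_swap (hf : FinSupp u) (hab : a < b)
    (hlen : len (u * Equiv.swap a b) = len u + 1) :
    u a < u b ∧ ∀ c, a < c → c < b → u a < u c → u b ≤ u c := by
  have hu : u a < u b := by
    by_contra! hle
    have hlt := lt_of_le_of_ne hle (u.injective.ne hab.ne')
    have := len_lt_len_mul_swap (hf.mul_swap a b) hab (by simpa using hlt)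
    rw [mul_assoc, Equiv.swap_mul_self, mul_one] at this
    omega
  refine ⟨hu, fun c hac hcb huc => ?_⟩
  by_contra! hcb'
  have hs : Equiv.swap a b c = c := Equiv.swap_apply_of_ne_of_ne hac.ne' hcb.ne
  have hfin := (hf.mul_swap a b).finite_inversions
  have hab_mem := mem_inversions_mul_swap hab hu
  have hac_mem : (a, c) ∈ inversions (u * Equiv.swap a b) \ {(a, b)} :=
    ⟨⟨hac, by simpa [hs] using hcb'⟩, by simp [hcb.ne]⟩
  have hfix : swapPair a b (a, c) = (a, c) := by
    simp [swapPair, hs, hcb.le]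
  have hsub : swapPair a b '' inversions u ⊆
      (inversions (u * Equiv.swap a b) \ {(a, b)}) \ {(a, c)} := by
    refine Set.subset_sdiff_singleton (swapPair_image_subset hab hu) ?_
    rintro ⟨p, hp, hpe⟩
    have : p = (a, c) := by
      rw [← swapPair_swapPair a b hp.1, hpe, hfix]
    subst this
    exact lt_asymm huc hp.2
  have h1 := Set.ncard_sdiff_singleton_add_one hab_mem hfin
  have h2 := Set.ncard_sdiff_singleton_add_one hac_mem hfin.sdiff
  have h3 := Set.ncard_le_ncard hsub hfin.sdiff.sdiff
  rw [(swapPair_injOn_inversions a b u).ncard_image] at h3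
  change (inversions (u * Equiv.swap a b)).ncard = (inversions u).ncard + 1 at hlen
  omega

end Swap

/-- A non-recursive criterion for `u ≤_k w`. -/
structure KBruhatCriterion (k : ℕ+) (u w : Equiv.Perm ℕ+) : Prop where
  le : ∀ a, a ≤ k → u a ≤ w a
  ge : ∀ b, k < b → w b ≤ u b
  lt : ∀ a b, a < b → (a ≤ k ↔ b ≤ k) → u a < u b → w a < w b

namespace KBruhatCriterion

variable {k : ℕ+} {u v w : Equiv.Perm ℕ+}

theorem refl (k : ℕ+) (u : Equiv.Perm ℕ+) : KBruhatCriterion k u u :=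
  ⟨fun _ _ => le_rfl, fun _ _ => le_rfl, fun _ _ _ _ h => h⟩

theorem trans (h₁ : KBruhatCriterion k u v) (h₂ : KBruhatCriterion k v w) :
    KBruhatCriterion k u w :=
  ⟨fun a ha => (h₁.le a ha).trans (h₂.le a ha), fun b hb => (h₂.ge b hb).trans (h₁.ge b hb),
    fun a b hab hs h => h₂.lt a b hab hs (h₁.lt a b hab hs h)⟩

theorem of_cov (hf : FinSupp u) (h : kBruhatCov k u w) : KBruhatCriterion k u w := by
  obtain ⟨a, b, hak, hkb, rfl, hlen⟩ := h
  obtain ⟨hu, hN⟩ := lt_and_not_between_of_len_mul_swap hf (hak.trans_lt hkb) hlen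
  have hinj := u.injective
  constructor
  · intro c hc
    simp only [Equiv.swap_apply_def, Equiv.Perm.mul_apply]
    grind
  · intro c hc
    simp only [Equiv.swap_apply_def, Equiv.Perm.mul_apply]
    grind
  · intro c d hcd hs hlt
    have h1 := hN c
    have h2 := hN d
    have h3 : c ≠ b → u c ≠ u b := fun h => hinj.ne h
    have h4 : d ≠ b → u d ≠ u b := fun h => hinj.ne h
    simp only [Equiv.swap_apply_def, Equiv.Perm.mul_apply]
    grind

end KBruhatCriterion

theorem kBruhat.finSupp {k : ℕ+} {u w : Equiv.Perm ℕ+} (h : kBruhat k u w) (hu : FinSupp u) :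
    FinSupp w := by
  induction h with
  | refl => exact hu
  | tail _ hc ih =>
    obtain ⟨a, b, -, -, rfl, -⟩ := hc
    exact ih.mul_swap a b

theorem kBruhat.criterion {k : ℕ+} {u w : Equiv.Perm ℕ+} (h : kBruhat k u w) (hu : FinSupp u) :
    KBruhatCriterion k u w := by
  induction h with
  | refl => exact .refl k u
  | tail hc hcov ih => exact ih.trans (.of_cov (kBruhat.finSupp hc hu) hcov)

theorem perm_eq_one_of_apply_le {f : Equiv.Perm ℕ+} (h : ∀ x, f x ≤ x) : f = 1 := by
  ext1 x
  induction x using PNat.strongInductionOn with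
  | _ x ih =>
    rcases (h x).lt_or_eq with hlt | heq
    · exact f.injective (ih _ hlt)
    · exact heq

namespace KBruhatCriterion

variable {k : ℕ+} {u w : Equiv.Perm ℕ+}

theorem exists_lt (h : KBruhatCriterion k u w) (hne : u ≠ w) : ∃ a ≤ k, u a < w a := by
  by_contra! hn
  refine hne (mul_inv_eq_one.1 (perm_eq_one_of_apply_le (f := w * u⁻¹) fun x => ?_)).symm
  obtain ⟨c, rfl⟩ := u.surjective x
  simp only [Equiv.Perm.mul_apply, Equiv.Perm.coe_inv, Equiv.symm_apply_apply]
  rcases le_or_gt c k with hc | hc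
  · exact hn c hc
  · exact h.ge c hc

theorem exists_descending (h : KBruhatCriterion k u w) {a : ℕ+} (ha : u a < w a)
    (hmax : ∀ c ≤ k, u a < u c → w c = u c) :
    ∃ b, k < b ∧ w b ≤ u a ∧ u a < u b ∧ u b ≤ w a := by
  by_contra! hn
  have hmaps : Set.MapsTo (w * u⁻¹) (Finset.Ioc (u a) (w a)) (Finset.Ioc (u a) (w a)) := by
    intro x hx
    obtain ⟨c, rfl⟩ := u.surjective x
    simp only [Finset.coe_Ioc, Set.mem_Ioc, Equiv.Perm.mul_apply,
      Equiv.Perm.coe_inv, Equiv.symm_apply_apply] at hx ⊢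
    rcases le_or_gt c k with hc | hc
    · rwa [hmax c hc hx.1]
    · refine ⟨?_, (h.ge c hc).trans hx.2⟩
      by_contra! hle
      exact absurd hx.2 (not_le.2 (hn c hc hle hx.1))
  have hsurj := Finset.surjOn_of_injOn_of_card_le _ hmaps
    (w * u⁻¹).injective.injOn le_rfl
  obtain ⟨x, hx, hxe⟩ := hsurj (show w a ∈ _ by simpa using ha)
  rw [Equiv.Perm.mul_apply] at hxe
  have : x = u a := by rw [← w.injective hxe]; simp
  simp [this] at hx

/-- If `u ≠ w` satisfy the criterion, some `k`-Bruhat cover of `u` still satisfies it with `w`. -/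
theorem exists_cov (h : KBruhatCriterion k u w) (hf : FinSupp u) (hne : u ≠ w) :
    ∃ a b, a ≤ k ∧ kBruhatCov k u (u * Equiv.swap a b) ∧
      KBruhatCriterion k (u * Equiv.swap a b) w ∧ u a < u b := by
  obtain ⟨a, ⟨hak, ha⟩, hmax⟩ := Set.exists_max_image {a | a ≤ k ∧ u a < w a} u
    ((Set.finite_Icc 1 k).subset fun a ha => ⟨one_le, ha.1⟩) (h.exists_lt hne)
  have hfix : ∀ c ≤ k, u a < u c → w c = u c := fun c hc hac => by
    by_contra hcne
    exact absurd (hmax c ⟨hc, lt_of_le_of_ne (h.le c hc) (Ne.symm hcne)⟩) (not_le.2 hac)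
  obtain ⟨b₀, hb₀⟩ := h.exists_descending ha hfix
  obtain ⟨b, ⟨hkb, hwb, hab, hba⟩, hmin⟩ :=
    Set.exists_min_image {b | k < b ∧ w b ≤ u a ∧ u a < u b ∧ u b ≤ w a} u
      (((Set.finite_Icc 1 (w a)).preimage u.injective.injOn).subset
        fun b hb => ⟨one_le, hb.2.2.2⟩) ⟨b₀, hb₀⟩
  have hmin' : ∀ c, k < c → u a < u c → u c < u b → u a < w c := fun c hkc hac hcb => by
    by_contra! hle
    exact absurd (hmin c ⟨hkc, hle, hac, hcb.le.trans hba⟩) (not_le.2 hcb)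
  refine ⟨a, b, hak, ⟨a, b, hak, hkb, rfl,
    len_mul_swap_eq hf (hak.trans_lt hkb) hab fun c hac hcb huc => ?_⟩, ⟨?_, ?_, ?_⟩, hab⟩
  · by_contra! hlt
    rcases le_or_gt c k with hc | hc
    · have h1 := h.lt a c hac (by simp [hak, hc]) huc
      rw [hfix c hc huc] at h1
      exact absurd (hlt.trans_le hba) h1.not_gt
    · have h1 := h.lt c b hcb (by simp [hkb.not_ge, hc.not_ge]) hlt
      exact absurd (hmin' c hc huc hlt) (h1.trans_le hwb).not_gt
  · intro c hc
    have := h.le c hc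
    simp only [Equiv.swap_apply_def, Equiv.Perm.mul_apply]
    grind
  · intro c hc
    have := h.ge c hc
    simp only [Equiv.swap_apply_def, Equiv.Perm.mul_apply]
    grind
  · intro c d hcd hs hlt
    have h1 := h.lt c d hcd hs
    have h2 := hfix c
    have h3 := hmin' d
    have h4 : c ≠ a → u c ≠ u a := fun h => u.injective.ne h
    have h5 : d ≠ b → u d ≠ u b := fun h => u.injective.ne h
    simp only [Equiv.swap_apply_def, Equiv.Perm.mul_apply] at hlt
    grind

theorem kBruhat (h : KBruhatCriterion k u w) (hf : FinSupp u) : kBruhat k u w := by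
  induction hn : ∑ c ∈ Finset.Icc 1 k, ((w c : ℕ) - (u c : ℕ)) using Nat.strong_induction_on
    generalizing u with
  | _ n ih =>
    by_cases hne : u = w
    · rw [hne]
      exact .refl
    obtain ⟨a, b, hak, hcov, hcrit, hab⟩ := h.exists_cov hf hne
    refine .head hcov (ih _ ?_ hcrit (hf.mul_swap a b) rfl)
    have hup := of_cov hf hcov
    rw [← hn]
    refine Finset.sum_lt_sum (fun c hc => ?_) ⟨a, by simp [hak], ?_⟩
    · have : (u c : ℕ) ≤ (u * Equiv.swap a b) c := hup.le c (Finset.mem_Icc.1 hc).2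
      omega
    · have h1 : ((u * Equiv.swap a b) a : ℕ) ≤ w a := hcrit.le a hak
      have h2 : (u a : ℕ) < (u * Equiv.swap a b) a := by simpa using hab
      omega

end KBruhatCriterion

theorem kBruhat_iff {k : ℕ+} {u w : Equiv.Perm ℕ+} (hu : FinSupp u) :
    kBruhat k u w ↔ KBruhatCriterion k u w :=
  ⟨fun h => h.criterion hu, fun h => h.kBruhat hu⟩

namespace NewOrder

variable {η ζ : Equiv.Perm ℕ+}

theorem between (h : NewOrder η ζ) (α : ℕ+) : (α ≤ η α ∧ η α ≤ ζ α) ∨ (ζ α ≤ η α ∧ η α ≤ α) := by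
  obtain ⟨x, l, hx, h1, h2⟩ := h
  have c1 := h1.criterion hx
  have c2 := h2.criterion (h1.finSupp hx)
  obtain ⟨c, rfl⟩ := x.surjective α
  rcases le_or_gt c l with hc | hc
  · exact .inl ⟨c1.le c hc, c2.le c hc⟩
  · exact .inr ⟨c2.ge c hc, c1.ge c hc⟩

theorem apply_lt_apply (h : NewOrder η ζ) {α β : ℕ+}
    (hside : (α ≤ ζ α ∧ β ≤ ζ β) ∨ (ζ α ≤ α ∧ ζ β ≤ β)) (hαβ : α < β) (hζ : ζ α < ζ β) :
    η α < η β := by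
  by_contra! hle
  have hα := h.between α
  have hβ := h.between β
  have hlt : η β < η α := lt_of_le_of_ne hle (η.injective.ne hαβ.ne')
  obtain ⟨x, l, hx, h1, h2⟩ := h
  have c1 := h1.criterion hx
  have c2 := h2.criterion (h1.finSupp hx)
  obtain ⟨a, rfl⟩ := x.surjective α
  obtain ⟨b, rfl⟩ := x.surjective β
  by_cases hs : a ≤ l ↔ b ≤ l
  · rcases lt_trichotomy a b with hab | rfl | hab
    · exact lt_asymm hlt (c1.lt a b hab hs hαβ)
    · exact lt_irrefl _ hαβ
    · exact lt_asymm hζ (c2.lt b a hab hs.symm hlt)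
  · have p1 : ∀ c ≤ l, x c ≤ η (x c) := c1.le
    have p2 : ∀ c ≤ l, η (x c) ≤ ζ (x c) := c2.le
    have p3 : ∀ c, l < c → η (x c) ≤ x c := c1.ge
    have p4 : ∀ c, l < c → ζ (x c) ≤ η (x c) := c2.ge
    grind

/-- If `η ⪯ ζ`, every `u` with `u ≤_k ζu` witnesses it. -/
theorem kBruhat (h : NewOrder η ζ) {u : Equiv.Perm ℕ+} {k : ℕ+} (hu : FinSupp u)
    (hk : kBruhat k u (ζ * u)) : kBruhat k u (η * u) ∧ kBruhat k (η * u) (ζ * u) := by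
  have c := hk.criterion hu
  have side : ∀ a b, (a ≤ k ↔ b ≤ k) → (u a ≤ ζ (u a) ∧ u b ≤ ζ (u b)) ∨
      (ζ (u a) ≤ u a ∧ ζ (u b) ≤ u b) := fun a b hs => by
    by_cases ha : a ≤ k
    · exact .inl ⟨c.le a ha, c.le b (hs.1 ha)⟩
    · exact .inr ⟨c.ge a (not_le.1 ha), c.ge b (not_le.1 (mt hs.2 ha))⟩
  have c1 : KBruhatCriterion k u (η * u) := by
    refine ⟨fun a ha => ?_, fun b hb => ?_, fun a b hab hs hlt => ?_⟩
    · have h1 := c.le a ha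
      have h2 := h.between (u a)
      simp only [Equiv.Perm.mul_apply] at h1 ⊢
      grind
    · have h1 := c.ge b hb
      have h2 := h.between (u b)
      simp only [Equiv.Perm.mul_apply] at h1 ⊢
      grind
    · exact h.apply_lt_apply (side a b hs) hlt (c.lt a b hab hs hlt)
  have h1 := c1.kBruhat hu
  refine ⟨h1, KBruhatCriterion.kBruhat ?_ (h1.finSupp hu)⟩
  refine ⟨fun a ha => ?_, fun b hb => ?_, fun a b hab hs hlt => ?_⟩
  · have h1 := c.le a ha
    have h2 := h.between (u a)
    simp only [Equiv.Perm.mul_apply] at h1 ⊢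
    grind
  · have h1 := c.ge b hb
    have h2 := h.between (u b)
    simp only [Equiv.Perm.mul_apply] at h1 ⊢
    grind
  · by_contra! hle
    have hne : (ζ * u) b ≠ (ζ * u) a := (ζ * u).injective.ne hab.ne'
    have hζ := lt_of_le_of_ne hle hne
    have hba : u b < u a := by
      by_contra! hab'
      exact lt_asymm hζ (c.lt a b hab hs (lt_of_le_of_ne hab' (u.injective.ne hab.ne)))
    exact lt_asymm hlt (h.apply_lt_apply (side b a hs.symm) hba hζ)

/-- If `u ≤_k ηu ≤_k ξ₁u ≤_k ξ₂u` then `ξ₁η⁻¹ ⪯ ξ₂η⁻¹`, witnessed by `ηu`. -/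
theorem mul_inv_right {ξ₁ ξ₂ : Equiv.Perm ℕ+} {u : Equiv.Perm ℕ+} {k : ℕ+} (hu : FinSupp (η * u))
    (h₁ : _root_.kBruhat k (η * u) (ξ₁ * u)) (h₂ : _root_.kBruhat k (ξ₁ * u) (ξ₂ * u)) :
    NewOrder (ξ₁ * η⁻¹) (ξ₂ * η⁻¹) :=
  ⟨η * u, k, hu, by simpa [mul_assoc] using h₁, by simpa [mul_assoc] using h₂⟩

/-- If `η ⪯ ζ` and `ξη⁻¹ ⪯ ζη⁻¹`, then `u ≤_k ηu ≤_k ξu ≤_k ζu` for some `u` and `k`. -/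
theorem exists_chain_of_mul_inv {ξ : Equiv.Perm ℕ+} (h : NewOrder η ζ)
    (hξ : NewOrder (ξ * η⁻¹) (ζ * η⁻¹)) :
    ∃ (u : Equiv.Perm ℕ+) (k : ℕ+), FinSupp u ∧ _root_.kBruhat k u (η * u) ∧
      _root_.kBruhat k (η * u) (ξ * u) ∧ _root_.kBruhat k (ξ * u) (ζ * u) := by
  obtain ⟨u, k, hu, h1, h2⟩ := h
  have h3 := hξ.kBruhat (h1.finSupp hu) (k := k) (by simpa [mul_assoc] using h2)
  exact ⟨u, k, hu, h1, by simpa [mul_assoc] using h3⟩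

end NewOrder


/-- For `η ⪯ ζ`, the map `ξ ↦ ξη⁻¹` induces an order isomorphism from
`[η,ζ]_⪯` onto `[e,ζη⁻¹]_⪯`: it maps the first interval into the second, is
onto the second, and preserves and reflects `⪯`. -/
theorem stmt_12 (η ζ : Equiv.Perm ℕ+) (hη : FinSupp η) (hζ : FinSupp ζ)
    (h : NewOrder η ζ) :
    (∀ ξ : Equiv.Perm ℕ+, NewOrder η ξ → NewOrder ξ ζ →
        NewOrder 1 (ξ * η⁻¹) ∧ NewOrder (ξ * η⁻¹) (ζ * η⁻¹)) ∧
    (∀ ξ' : Equiv.Perm ℕ+, NewOrder 1 ξ' → NewOrder ξ' (ζ * η⁻¹) →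
        ∃ ξ : Equiv.Perm ℕ+, NewOrder η ξ ∧ NewOrder ξ ζ ∧ ξ * η⁻¹ = ξ') ∧
    (∀ ξ₁ ξ₂ : Equiv.Perm ℕ+, NewOrder η ξ₁ → NewOrder ξ₁ ζ →
        NewOrder η ξ₂ → NewOrder ξ₂ ζ →
        (NewOrder ξ₁ ξ₂ ↔ NewOrder (ξ₁ * η⁻¹) (ξ₂ * η⁻¹))) := by
  refine ⟨fun ξ h1 h2 => ?_, fun ξ' _ h2 => ?_, fun ξ₁ ξ₂ h1 _ h3 _ => ⟨fun h12 => ?_, fun h12 => ?_⟩⟩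
  · obtain ⟨u, k, hu, h3, h4⟩ := h2
    obtain ⟨h5, h6⟩ := h1.kBruhat hu h3
    have hηu := h5.finSupp hu
    exact ⟨by simpa using NewOrder.mul_inv_right hηu .refl h6, .mul_inv_right hηu h6 h4⟩
  · obtain ⟨u, k, hu, h3, h4, h5⟩ :=
      h.exists_chain_of_mul_inv (ξ := ξ' * η) (by simpa using h2)
    exact ⟨ξ' * η, ⟨u, k, hu, h3, h4⟩, ⟨u, k, hu, h3.trans h4, h5⟩, by simp⟩
  · obtain ⟨u, k, hu, h4, h5⟩ := h12
    obtain ⟨h6, h7⟩ := h1.kBruhat hu h4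
    exact .mul_inv_right (h6.finSupp hu) h7 h5
  · obtain ⟨u, k, hu, h4, h5, h6⟩ := h3.exists_chain_of_mul_inv h12
    exact ⟨u, k, hu, h4.trans h5, h6⟩
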